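/- arXiv:2310.12697 — 4 statements merged into one kernel-verified Lean document; each statement's English description precedes it below -/
import Mathlib

section
/- For every integer j ≥ 1, the derivatives of G_j at 0 satisfy: the (j-1)-th derivative of G_j at 0 equals (j-1)!, the j-th derivative of G_j at 0 equals j!/2, the (j+1)-th derivative of G_j at 0 equals (j+1)!/12, and the (j+2)-th derivative of G_j at 0 equals 0. -/
/-- `G_j(v) = v^j/(1 - e^{-v})` for `v ≠ 0`, `G_1(0) = 1`, and `G_j(0) = 0` for `j > 1`. -/
noncomputable def G (j : ℕ) : ℝ → ℝ := fun v =>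
  if v = 0 then (if j = 1 then 1 else 0) else v ^ j / (1 - Real.exp (-v))

/-- The Taylor coefficients at `0` of `v ↦ v ^ m * f v` are those of `f`, shifted by `m`. -/
theorem iteratedDeriv_pow_mul_zero {f : ℝ → ℝ} (m k : ℕ) (hf : ContDiffAt ℝ (m + k : ℕ) f 0) :
    iteratedDeriv (m + k) (fun v => v ^ m * f v) 0 =
      (m + k).choose m * m.factorial * iteratedDeriv k f 0 := by
  rw [iteratedDeriv_fun_mul (by fun_prop) hf, Finset.sum_eq_single m]
  · simp only [iteratedDeriv_fun_pow_zero, if_true, Nat.add_sub_cancel_left]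
  · intro i _ hi
    rw [iteratedDeriv_fun_pow_zero, if_neg hi, Nat.cast_zero, mul_zero, zero_mul]
  · intro h
    simp at h

theorem G_succ (m : ℕ) : G (m + 1) = fun v => v ^ m * G 1 v := by
  funext v
  by_cases hv : v = 0
  · simp [G, hv, zero_pow_eq]
  · simp only [G, if_neg hv]
    ring

theorem G_one_mul (v : ℝ) : G 1 v * (1 - Real.exp (-v)) = v := by
  by_cases hv : v = 0
  · simp [hv]
  · have h : 1 - Real.exp (-v) ≠ 0 := by
      rw [sub_ne_zero, ne_comm]
      simpa using hv
    simp [G, hv, h]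

theorem analyticAt_one_sub_exp_neg (x : ℝ) :
    AnalyticAt ℝ (fun v => 1 - Real.exp (-v)) x := by
  fun_prop

theorem G_one_eq_inv_dslope : G 1 = (dslope (fun v => 1 - Real.exp (-v)) 0)⁻¹ := by
  funext v
  by_cases hv : v = 0
  · have h : HasDerivAt (fun v : ℝ => 1 - Real.exp (-v)) 1 0 := by
      simpa using ((hasDerivAt_neg (0 : ℝ)).exp.const_sub 1)
    simp [G, hv, h.deriv]
  · simp [G, hv, dslope_of_ne, slope_def_field]

theorem analyticAt_G_one : AnalyticAt ℝ (G 1) 0 := by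
  obtain ⟨p, hp⟩ := analyticAt_one_sub_exp_neg 0
  rw [G_one_eq_inv_dslope]
  refine AnalyticAt.inv ⟨_, hp.has_fpower_series_dslope_fslope⟩ fun h => ?_
  have h1 := congrFun G_one_eq_inv_dslope 0
  rw [Pi.inv_apply, h] at h1
  simp [G] at h1

theorem iteratedDeriv_one_sub_exp_neg_zero (n : ℕ) :
    iteratedDeriv n (fun v => 1 - Real.exp (-v)) 0 = if n = 0 then 0 else -(-1) ^ n := by
  rcases Nat.eq_zero_or_pos n with rfl | hn
  · simp
  · have h := congrFun (iteratedDeriv_exp_const_mul n (-1)) 0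
    simp only [neg_one_mul] at h
    rw [iteratedDeriv_const_sub hn, iteratedDeriv_neg, h]
    simp [hn.ne']

theorem sum_choose_mul_iteratedDeriv_G_one (n : ℕ) :
    ∑ i ∈ Finset.range (n + 1), (n.choose i : ℝ) * iteratedDeriv i (G 1) 0 *
      (if n - i = 0 then 0 else -(-1) ^ (n - i)) = if n = 1 then 1 else 0 := by
  rw [← iteratedDeriv_fun_id_zero (𝕜 := ℝ)]
  simp_rw [← iteratedDeriv_one_sub_exp_neg_zero]
  rw [← iteratedDeriv_fun_mul analyticAt_G_one.contDiffAt
    (analyticAt_one_sub_exp_neg 0).contDiffAt]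
  simp_rw [G_one_mul]

theorem iteratedDeriv_G_one_zero :
    iteratedDeriv 0 (G 1) 0 = 1 ∧ iteratedDeriv 1 (G 1) 0 = 1 / 2 ∧
      iteratedDeriv 2 (G 1) 0 = 1 / 6 ∧ iteratedDeriv 3 (G 1) 0 = 0 := by
  have h1 := sum_choose_mul_iteratedDeriv_G_one 1
  have h2 := sum_choose_mul_iteratedDeriv_G_one 2
  have h3 := sum_choose_mul_iteratedDeriv_G_one 3
  have h4 := sum_choose_mul_iteratedDeriv_G_one 4
  norm_num [Finset.sum_range_succ, Nat.choose, -iteratedDeriv_zero, -iteratedDeriv_one]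
    at h1 h2 h3 h4
  refine ⟨?_, ?_, ?_, ?_⟩ <;> linarith

/-- For `j ≥ 1`: `G_j^{(j-1)}(0) = (j-1)!`, `G_j^{(j)}(0) = j!/2`,
`G_j^{(j+1)}(0) = (j+1)!/12`, and `G_j^{(j+2)}(0) = 0`. -/
theorem iteratedDeriv_G_zero_special_values (j : ℕ) (hj : 1 ≤ j) :
    iteratedDeriv (j - 1) (G j) 0 = Nat.factorial (j - 1) ∧
    iteratedDeriv j (G j) 0 = (Nat.factorial j : ℝ) / 2 ∧
    iteratedDeriv (j + 1) (G j) 0 = (Nat.factorial (j + 1) : ℝ) / 12 ∧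
    iteratedDeriv (j + 2) (G j) 0 = 0 := by
  obtain ⟨m, rfl⟩ : ∃ m, j = m + 1 := ⟨j - 1, by omega⟩
  obtain ⟨h0, h1, h2, h3⟩ := iteratedDeriv_G_one_zero
  have key (k : ℕ) : iteratedDeriv (m + k) (G (m + 1)) 0 =
      (m + k).factorial / k.factorial * iteratedDeriv k (G 1) 0 := by
    rw [G_succ, iteratedDeriv_pow_mul_zero m k analyticAt_G_one.contDiffAt,
      ← Nat.add_choose_mul_factorial_mul_factorial m k]
    have := Nat.cast_ne_zero (R := ℝ).2 k.factorial_ne_zero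
    rw [Nat.choose_symm_add]
    push_cast
    field_simp
  refine ⟨?_, ?_, ?_, ?_⟩
  · simpa [h0] using key 0
  · rw [key 1, h1]
    simp [div_eq_mul_inv]
  · rw [add_assoc, key 2, h2]
    norm_num [Nat.factorial]
    ring
  · rw [add_assoc, key 3, h3, mul_zero]
end

section
/- For every integer j ≥ 1 and every real v with |v| < 2π, f_j(v) = Σ_{i=0}^{∞} (-1)^{i+1} (i+1)(i+2)(j+i)! · [Σ_{q=0}^{i+1} ((-1)^q/(q+1)) · S(i+q+1, q)/((i-q+1)!(i+q+1)!)] · v^i, and this series converges for |v| < 2π. -/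
/-- The Stirling numbers of the second kind `S(n,k)`. -/
def S : ℕ → ℕ → ℕ
  | 0, 0 => 1
  | 0, _ + 1 => 0
  | _ + 1, 0 => 0
  | n + 1, k + 1 => (k + 1) * S n (k + 1) + S n k

open PowerSeries in
/-- The exponential generating function of `S(·, q)` is `(e^X - 1)^q / q!`. -/
theorem coeff_exp_sub_one_pow (m q : ℕ) :
    coeff m ((exp ℚ - 1) ^ q) = (q.factorial : ℚ) * S m q / m.factorial := by
  induction m generalizing q with
  | zero => cases q <;> simp [S]
  | succ m ih =>
    cases q with
    | zero => simp [S, coeff_one]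
    | succ q =>
      have hD : derivative ℚ ((exp ℚ - 1) ^ (q + 1)) =
          C ((q : ℚ) + 1) * ((exp ℚ - 1) ^ (q + 1) + (exp ℚ - 1) ^ q) := by
        rw [derivative_pow, map_sub, derivative_exp, derivative_one]
        simp only [Nat.add_sub_cancel, map_add, map_one, Nat.cast_add, Nat.cast_one, map_natCast]
        ring
      have h := congrArg (coeff m) hD
      rw [coeff_derivative, coeff_C_mul, map_add, ih, ih] at h
      have hm : (m : ℚ) + 1 ≠ 0 := by positivity
      rw [← mul_left_inj' hm, h]
      simp only [S, Nat.factorial_succ]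
      push_cast
      field_simp

open PowerSeries in
/-- The Bernoulli numbers in terms of Stirling numbers of the second kind. -/
theorem bernoulli_eq_sum_S (n : ℕ) :
    bernoulli n = (n.factorial : ℚ) * (n + 1).factorial *
      ∑ q ∈ Finset.range (n + 1), (-1 : ℚ) ^ q / (q + 1) * S (n + q) q /
        ((n - q).factorial * (n + q).factorial) := by
  obtain ⟨w, hw⟩ : (X : ℚ⟦X⟧) ∣ exp ℚ - 1 := by
    rw [X_dvd_iff]; simp
  have hbw : bernoulliPowerSeries ℚ * w = 1 := by
    have h := bernoulliPowerSeries_mul_exp_sub_one ℚ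
    rw [hw, mul_left_comm] at h
    exact mul_left_cancel₀ X_ne_zero (h.trans (mul_one X).symm)
  have hwcoeff (q : ℕ) : coeff n (w ^ q) = (q.factorial : ℚ) * S (n + q) q / (n + q).factorial := by
    rw [← coeff_exp_sub_one_pow, hw, mul_pow, coeff_X_pow_mul]
  have hw0 : X ∣ 1 - w := by
    have h := congrArg (coeff 1) hw
    rw [X_dvd_iff]
    rw [show (1 : ℕ) = 0 + 1 from rfl, coeff_succ_X_mul] at h
    have hw1 : constantCoeff w = 1 := by simpa [coeff_one] using h.symm
    simp [hw1]
  have hbinom : (1 - w) ^ (n + 1) =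
      1 - w * ∑ q ∈ Finset.range (n + 1), C ((-1 : ℚ) ^ q * (n + 1).choose (q + 1)) * w ^ q := by
    rw [sub_eq_neg_add, add_pow, Finset.sum_range_succ', Finset.mul_sum, sub_eq_neg_add,
      ← Finset.sum_neg_distrib]
    congr 1
    · refine Finset.sum_congr rfl fun q _ => ?_
      simp only [map_mul, map_pow, map_neg, map_one, map_natCast, one_pow, neg_pow w]
      ring
    · simp
  have hP : bernoulliPowerSeries ℚ =
      ∑ q ∈ Finset.range (n + 1), C ((-1 : ℚ) ^ q * (n + 1).choose (q + 1)) * w ^ q +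
        bernoulliPowerSeries ℚ * (1 - w) ^ (n + 1) := by
    rw [hbinom, mul_sub, ← mul_assoc, hbw]
    ring
  have hrem : coeff n (bernoulliPowerSeries ℚ * (1 - w) ^ (n + 1)) = 0 :=
    X_pow_dvd_iff.1 ((pow_dvd_pow_of_dvd hw0 _).mul_left _) n n.lt_succ_self
  have h := congrArg (coeff n) hP
  rw [map_add, hrem, add_zero, map_sum, bernoulliPowerSeries, coeff_mk] at h
  have hn : (n.factorial : ℚ) ≠ 0 := by positivity
  rw [Algebra.algebraMap_self_apply, div_eq_iff hn] at h
  rw [h, mul_comm, mul_assoc]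
  congr 1
  rw [Finset.mul_sum]
  refine Finset.sum_congr rfl fun q hq => ?_
  rw [coeff_C_mul, hwcoeff, Nat.cast_choose ℚ (by simpa using hq), Nat.add_sub_add_right,
    Nat.factorial_succ q]
  push_cast
  field_simp

/-- The Taylor series at `0` of a complex function. -/
noncomputable def taylorPowerSeries (f : ℂ → ℂ) : PowerSeries ℂ :=
  .mk fun n => iteratedDeriv n f 0 / n.factorial

theorem taylorPowerSeries_mul {f g : ℂ → ℂ} (hf : AnalyticAt ℂ f 0) (hg : AnalyticAt ℂ g 0) :
    taylorPowerSeries (f * g) = taylorPowerSeries f * taylorPowerSeries g := by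
  ext n
  simp only [taylorPowerSeries, PowerSeries.coeff_mul, PowerSeries.coeff_mk]
  rw [iteratedDeriv_mul hf.contDiffAt hg.contDiffAt, Finset.sum_div,
    Finset.Nat.sum_antidiagonal_eq_sum_range_succ_mk]
  refine Finset.sum_congr rfl fun i hi => ?_
  have hn : (n.factorial : ℂ) ≠ 0 := Nat.cast_ne_zero.2 n.factorial_ne_zero
  rw [Nat.cast_choose ℂ (by simpa [Nat.lt_succ_iff] using hi)]
  field_simp

theorem taylorPowerSeries_pow_id (k : ℕ) :
    taylorPowerSeries (fun z => z ^ k) = PowerSeries.X ^ k := by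
  ext n
  rw [taylorPowerSeries, PowerSeries.coeff_mk, iteratedDeriv_fun_pow_zero, PowerSeries.coeff_X_pow]
  split_ifs with h
  · subst h; exact div_self (Nat.cast_ne_zero.2 n.factorial_ne_zero)
  · simp

theorem taylorPowerSeries_exp : taylorPowerSeries Complex.exp = PowerSeries.exp ℂ := by
  ext n
  simp [taylorPowerSeries, iteratedDeriv_eq_iterate]

theorem taylorPowerSeries_exp_sub_one :
    taylorPowerSeries (fun z => Complex.exp z - 1) = PowerSeries.exp ℂ - 1 := by
  rw [← taylorPowerSeries_exp]
  ext n
  have h : iteratedDeriv n (fun z => Complex.exp z - 1) 0 =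
      iteratedDeriv n Complex.exp 0 - iteratedDeriv n (fun _ : ℂ => (1 : ℂ)) 0 :=
    iteratedDeriv_fun_sub Complex.contDiff_exp.contDiffAt contDiffAt_const
  rw [map_sub, taylorPowerSeries, taylorPowerSeries, PowerSeries.coeff_mk, PowerSeries.coeff_mk, h,
    iteratedDeriv_const, PowerSeries.coeff_one]
  split_ifs with hn
  · simp [hn]
  · simp

/-- The complex extension of `G`. -/
noncomputable def complexG (j : ℕ) (z : ℂ) : ℂ :=
  if z = 0 then (if j = 1 then 1 else 0) else z ^ j / (1 - Complex.exp (-z))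

theorem complexG_ofReal (j : ℕ) (v : ℝ) : complexG j v = G j v := by
  unfold complexG G
  split_ifs <;> simp_all

theorem one_sub_exp_neg_ne_zero {z : ℂ} (hz : ‖z‖ < 2 * Real.pi) (h0 : z ≠ 0) :
    1 - Complex.exp (-z) ≠ 0 := by
  intro h
  obtain ⟨n, hn⟩ := Complex.exp_eq_one_iff.1 (sub_eq_zero.1 h).symm
  have hn0 : n ≠ 0 := by
    rintro rfl
    simp_all
  have hnorm : ‖z‖ = |(n : ℝ)| * (2 * Real.pi) := by
    rw [← norm_neg, hn]
    simp [abs_of_pos Real.pi_pos]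
  have h1 : (1 : ℝ) ≤ |(n : ℝ)| := by exact_mod_cast Int.one_le_abs hn0
  nlinarith [Real.pi_pos]

theorem continuousAt_complexG (k : ℕ) : ContinuousAt (complexG (k + 1)) 0 := by
  have hd : HasDerivAt (fun z : ℂ => 1 - Complex.exp (-z)) 1 0 := by
    simpa using ((hasDerivAt_neg (0 : ℂ)).cexp).const_sub 1
  have hslope := (hasDerivAt_iff_tendsto_slope.1 hd).inv₀ one_ne_zero
  have hpow : Filter.Tendsto (fun z : ℂ => z ^ k) (nhdsWithin 0 {0}ᶜ) (nhds (0 ^ k)) :=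
    ((continuous_pow k).tendsto 0).mono_left nhdsWithin_le_nhds
  have h := hpow.mul hslope
  rw [continuousAt_iff_punctured_nhds]
  have hval : complexG (k + 1) 0 = 0 ^ k * 1⁻¹ := by
    cases k <;> simp [complexG]
  rw [hval]
  refine h.congr' ?_
  filter_upwards [self_mem_nhdsWithin] with z hz
  have hz0 : z ≠ 0 := hz
  simp only [complexG, if_neg hz0, slope_def_field, neg_zero, Complex.exp_zero, sub_self, sub_zero,
    inv_div]
  ring

theorem differentiableOn_complexG (k : ℕ) :
    DifferentiableOn ℂ (complexG (k + 1)) (Metric.ball 0 (2 * Real.pi)) := by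
  rw [← Complex.differentiableOn_compl_singleton_and_continuousAt_iff
    (Metric.ball_mem_nhds 0 Real.two_pi_pos)]
  refine ⟨?_, continuousAt_complexG k⟩
  have hd : DifferentiableOn ℂ (fun z : ℂ => z ^ (k + 1) / (1 - Complex.exp (-z)))
      (Metric.ball 0 (2 * Real.pi) \ {0}) :=
    DifferentiableOn.div (by fun_prop) (by fun_prop) fun z hz =>
      one_sub_exp_neg_ne_zero (by simpa using hz.1) hz.2
  exact hd.congr fun z hz => if_neg hz.2

theorem taylorPowerSeries_complexG (k : ℕ) :
    taylorPowerSeries (complexG (k + 1)) = PowerSeries.X ^ k * bernoulli'PowerSeries ℂ := by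
  have han : AnalyticAt ℂ (complexG (k + 1)) 0 :=
    (differentiableOn_complexG k).analyticAt (Metric.ball_mem_nhds 0 Real.two_pi_pos)
  have hexp : AnalyticAt ℂ (fun z => Complex.exp z - 1) 0 := by fun_prop
  have hfun : (complexG (k + 1) * fun z => Complex.exp z - 1) =ᶠ[nhds 0]
      ((fun z => z ^ (k + 1)) * Complex.exp) := by
    filter_upwards [Metric.ball_mem_nhds 0 Real.two_pi_pos] with z hz
    by_cases h0 : z = 0
    · simp [h0]
    · have hne := one_sub_exp_neg_ne_zero (by simpa using hz) h0
      have hmul : Complex.exp z * (1 - Complex.exp (-z)) = Complex.exp z - 1 := by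
        rw [mul_sub, ← Complex.exp_add]; simp
      simp only [Pi.mul_apply, complexG, if_neg h0, ← hmul]
      field_simp
  have hne : PowerSeries.exp ℂ - 1 ≠ 0 := fun h => by
    simpa [PowerSeries.coeff_one] using congrArg (PowerSeries.coeff 1) h
  apply mul_right_cancel₀ hne
  rw [mul_assoc, bernoulli'PowerSeries_mul_exp_sub_one, ← mul_assoc, ← pow_succ,
    ← taylorPowerSeries_exp_sub_one, ← taylorPowerSeries_mul han hexp, ← taylorPowerSeries_exp,
    ← taylorPowerSeries_pow_id, ← taylorPowerSeries_mul (by fun_prop) (by fun_prop)]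
  ext n
  rw [taylorPowerSeries, taylorPowerSeries, PowerSeries.coeff_mk, PowerSeries.coeff_mk,
    hfun.iteratedDeriv_eq n]

theorem iteratedDeriv_complexG_zero (k i : ℕ) :
    iteratedDeriv (i + (k + 1)) (complexG (k + 1)) 0 =
      (k + 1 + i).factorial * (bernoulli' (i + 1) / (i + 1).factorial : ℚ) := by
  have h := congrArg (PowerSeries.coeff (i + 1 + k)) (taylorPowerSeries_complexG k)
  rw [PowerSeries.coeff_X_pow_mul, taylorPowerSeries, bernoulli'PowerSeries, PowerSeries.coeff_mk,
    PowerSeries.coeff_mk, div_eq_iff (Nat.cast_ne_zero.2 (Nat.factorial_ne_zero _))] at h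
  rw [show i + (k + 1) = i + 1 + k by ring, h, show i + 1 + k = k + 1 + i by ring, mul_comm,
    eq_ratCast]

theorem DifferentiableOn.iteratedDeriv_of_isOpen {f : ℂ → ℂ} {s : Set ℂ}
    (hf : DifferentiableOn ℂ f s) (hs : IsOpen s) (n : ℕ) :
    DifferentiableOn ℂ (iteratedDeriv n f) s := by
  induction n with
  | zero => simpa using hf
  | succ n ih => rw [iteratedDeriv_succ]; exact ih.deriv hs

theorem iteratedDeriv_eq_re_of_eqOn {f : ℂ → ℂ} {g : ℝ → ℝ} {r : ℝ}
    (hf : DifferentiableOn ℂ f (Metric.ball 0 r)) (hfg : ∀ x : ℝ, |x| < r → (f x).re = g x)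
    (n : ℕ) (x : ℝ) (hx : |x| < r) : iteratedDeriv n g x = (iteratedDeriv n f x).re := by
  induction n generalizing x with
  | zero => simpa using (hfg x hx).symm
  | succ n ih =>
    have hd : HasDerivAt (iteratedDeriv n f) (deriv (iteratedDeriv n f) x) x :=
      ((hf.iteratedDeriv_of_isOpen Metric.isOpen_ball n).differentiableAt
        (Metric.isOpen_ball.mem_nhds (by simpa using hx))).hasDerivAt
    have heq : iteratedDeriv n g =ᶠ[nhds x] fun y : ℝ => (iteratedDeriv n f y).re := by
      filter_upwards [(isOpen_lt continuous_abs continuous_const).mem_nhds hx] with y hy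
      exact ih y hy
    rw [iteratedDeriv_succ, iteratedDeriv_succ, heq.deriv_eq, hd.real_of_complex.deriv]

/-- For `j ≥ 1` and `|v| < 2π`, the power series of `f_j = G_j^{(j)}`:
`f_j(v) = Σ_{i≥0} (-1)^{i+1}(i+1)(i+2)(j+i)! [Σ_{q=0}^{i+1} ((-1)^q/(q+1)) S(i+q+1,q)/((i-q+1)!(i+q+1)!)] v^i`,
the series converging for `|v| < 2π`. -/
theorem f_powerSeries (j : ℕ) (hj : 1 ≤ j) (v : ℝ) (hv : |v| < 2 * Real.pi) :
    HasSum
      (fun i : ℕ =>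
        (-1 : ℝ) ^ (i + 1) * (i + 1) * (i + 2) * (Nat.factorial (j + i)) *
          (∑ q ∈ Finset.range (i + 2),
            ((-1 : ℝ) ^ q / (q + 1)) * (S (i + q + 1) q) /
              ((Nat.factorial (i + 1 - q)) * (Nat.factorial (i + q + 1)))) * v ^ i)
      (iteratedDeriv j (G j) v) := by
  obtain ⟨k, rfl⟩ := Nat.exists_eq_add_of_le' hj
  have hdiff := differentiableOn_complexG k
  have hsum := Complex.hasSum_re (Complex.hasSum_taylorSeries_on_ball
    (hdiff.iteratedDeriv_of_isOpen Metric.isOpen_ball (k + 1))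
    (z := (v : ℂ)) (by simpa using hv))
  rw [iteratedDeriv_eq_re_of_eqOn hdiff (fun x _ => by simp [complexG_ofReal]) _ v hv]
  convert hsum using 2 with i
  have hiter : iteratedDeriv i (iteratedDeriv (k + 1) (complexG (k + 1))) =
      iteratedDeriv (i + (k + 1)) (complexG (k + 1)) := by
    simp only [iteratedDeriv_eq_iterate, Function.iterate_add_apply]
  have hre : (i.factorial : ℂ)⁻¹ • ((v : ℂ) - 0) ^ i •
      ((k + 1 + i).factorial * ((bernoulli' (i + 1) / (i + 1).factorial : ℚ) : ℂ)) =
      (((i.factorial : ℝ)⁻¹ * (v ^ i *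
        ((k + 1 + i).factorial * (bernoulli' (i + 1) / (i + 1).factorial : ℚ))) : ℝ) : ℂ) := by
    push_cast
    simp
  rw [hiter, iteratedDeriv_complexG_zero, hre, Complex.ofReal_re, bernoulli'_eq_bernoulli,
    bernoulli_eq_sum_S]
  push_cast
  simp only [Nat.factorial_succ, show ∀ q, i + q + 1 = i + 1 + q from fun q => by ring]
  push_cast
  field_simp
  ring
end

section
/- For every integer j ≥ 1, every integer k ≥ 0, and every real v ≠ 0, the k-th derivative of G_j at v equals v^{j-k-1} · Σ_{q=0}^{k} [Σ_{ℓ=q}^{k} (-1)^{ℓ-q} · C(k,ℓ) · ⟨j⟩_{k-ℓ} · (ℓ-q)! · S(ℓ+1, ℓ-q+1) · (v/(1 - e^{-v}))^{ℓ-q+1}] · v^q, where v^{j-k-1} is the integer power of the nonzero real v and C(k,ℓ) denotes the binomial coefficient. -/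
open scoped Topology

lemma S_eq_zero_of_lt : ∀ {n k : ℕ}, n < k → S n k = 0
  | 0, k + 1, _ => by simp [S]
  | n + 1, k + 1, h => by
    simp [S, S_eq_zero_of_lt (show n < k + 1 by omega), S_eq_zero_of_lt (show n < k by omega)]

lemma one_sub_exp_neg_ne_zero_s5 {v : ℝ} (hv : v ≠ 0) : 1 - Real.exp (-v) ≠ 0 := by
  rw [sub_ne_zero, ne_comm, Ne, Real.exp_eq_one_iff, neg_eq_zero]
  exact hv

lemma hasDerivAt_inv_one_sub_exp_neg {v : ℝ} (hv : v ≠ 0) :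
    HasDerivAt (fun x : ℝ => (1 - Real.exp (-x))⁻¹)
      ((1 - Real.exp (-v))⁻¹ - (1 - Real.exp (-v))⁻¹ ^ 2) v := by
  have hne := one_sub_exp_neg_ne_zero_s5 hv
  refine (((hasDerivAt_neg v).exp.const_sub 1).fun_inv hne).congr_deriv ?_
  field_simp
  ring

lemma iteratedDeriv_inv_one_sub_exp_neg (n : ℕ) {v : ℝ} (hv : v ≠ 0) :
    iteratedDeriv n (fun x : ℝ => (1 - Real.exp (-x))⁻¹) v =
      ∑ m ∈ Finset.range (n + 1), (-1 : ℝ) ^ m * m.factorial * S (n + 1) (m + 1) *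
        (1 - Real.exp (-v))⁻¹ ^ (m + 1) := by
  induction n generalizing v with
  | zero => simp [S]
  | succ n ih =>
    have heq : iteratedDeriv n (fun x : ℝ => (1 - Real.exp (-x))⁻¹) =ᶠ[𝓝 v] fun x =>
        ∑ m ∈ Finset.range (n + 1), (-1 : ℝ) ^ m * m.factorial * S (n + 1) (m + 1) *
          (1 - Real.exp (-x))⁻¹ ^ (m + 1) := by
      filter_upwards [isOpen_ne.mem_nhds hv] with x hx using ih hx
    rw [iteratedDeriv_succ, heq.deriv_eq]
    have hd := HasDerivAt.fun_sum (u := Finset.range (n + 1)) fun m _ =>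
      ((hasDerivAt_inv_one_sub_exp_neg hv).fun_pow (m + 1)).const_mul
        ((-1 : ℝ) ^ m * m.factorial * S (n + 1) (m + 1))
    rw [hd.deriv]
    generalize (1 - Real.exp (-v))⁻¹ = h
    have hS (m : ℕ) : (-1 : ℝ) ^ m * m.factorial * S (n + 1 + 1) (m + 1) * h ^ (m + 1) =
        (-1 : ℝ) ^ m * m.factorial * (m + 1) * S (n + 1) (m + 1) * h ^ (m + 1) +
          (-1 : ℝ) ^ m * m.factorial * S (n + 1) m * h ^ (m + 1) := by
      rw [S]
      push_cast
      ring
    have hS_zero : S (n + 1) 0 = 0 := by simp [S]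
    have hS_top : S (n + 1) (n + 1 + 1) = 0 := S_eq_zero_of_lt (by omega)
    rw [Finset.sum_congr rfl fun m _ => hS m, Finset.sum_add_distrib,
      Finset.sum_range_succ _ (n + 1), Finset.sum_range_succ' _ (n + 1), hS_top, hS_zero]
    simp only [Nat.cast_zero, mul_zero, zero_mul, add_zero]
    rw [← Finset.sum_add_distrib]
    refine Finset.sum_congr rfl fun m _ => ?_
    rw [Nat.factorial_succ]
    push_cast
    ring

lemma G_eventuallyEq (j : ℕ) {v : ℝ} (hv : v ≠ 0) :
    G j =ᶠ[𝓝 v] fun x => (1 - Real.exp (-x))⁻¹ * x ^ j := by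
  filter_upwards [isOpen_ne.mem_nhds hv] with x hx
  rw [G, if_neg hx, div_eq_inv_mul]

/-- Closed form for `G_j^{(k)}(v)` at `v ≠ 0`:
`G_j^{(k)}(v) = v^{j-k-1} Σ_{q=0}^{k} [Σ_{ℓ=q}^{k} (-1)^{ℓ-q} C(k,ℓ) ⟨j⟩_{k-ℓ} (ℓ-q)!
S(ℓ+1,ℓ-q+1) (v/(1-e^{-v}))^{ℓ-q+1}] v^q`, where `v^{j-k-1}` is an integer power. -/
theorem iteratedDeriv_G_closed_form (j k : ℕ) (hj : 1 ≤ j) (v : ℝ) (hv : v ≠ 0) :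
    iteratedDeriv k (G j) v =
      v ^ ((j : ℤ) - k - 1) *
        ∑ q ∈ Finset.range (k + 1),
          (∑ ℓ ∈ Finset.Icc q k,
            (-1 : ℝ) ^ (ℓ - q) * (Nat.choose k ℓ) * (Nat.descFactorial j (k - ℓ)) *
              (Nat.factorial (ℓ - q)) * (S (ℓ + 1) (ℓ - q + 1)) *
              (v / (1 - Real.exp (-v))) ^ (ℓ - q + 1)) * v ^ q := by
  have hh : ContDiffAt ℝ k (fun x : ℝ => (1 - Real.exp (-x))⁻¹) v :=
    ContDiffAt.inv (by fun_prop) (one_sub_exp_neg_ne_zero_s5 hv)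
  rw [(G_eventuallyEq j hv).iteratedDeriv_eq k, iteratedDeriv_fun_mul hh (by fun_prop)]
  simp only [iteratedDeriv_inv_one_sub_exp_neg _ hv, iteratedDeriv_pow, Finset.mul_sum,
    Finset.sum_mul]
  conv_rhs => rw [Finset.sum_comm' (t' := Finset.range (k + 1)) (s' := fun ℓ => Finset.range (ℓ + 1))
    (by intro q ℓ; simp only [Finset.mem_range, Finset.mem_Icc]; omega)]
  refine Finset.sum_congr rfl fun ℓ hℓ => ?_
  rw [← Finset.sum_range_reflect]
  refine Finset.sum_congr rfl fun q hq => ?_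
  rw [Finset.mem_range] at hℓ hq
  rw [show ℓ + 1 - 1 - q = ℓ - q by omega]
  rcases lt_or_ge j (k - ℓ) with hlt | hle
  · simp [Nat.descFactorial_eq_zero_iff_lt.mpr hlt]
  have hpow : v ^ (j - (k - ℓ)) = v ^ ((j : ℤ) - k - 1) * (v ^ (ℓ - q + 1) * v ^ q) := by
    rw [← pow_add, ← zpow_natCast, ← zpow_natCast, ← zpow_add₀ hv]
    congr 1
    omega
  rw [hpow, div_eq_mul_inv, mul_pow]
  ring
end

section
/- For every integer j ≥ 1 and every integer k ≥ 0, the k-th derivative at 0 of the function 𝔤_j(v) = (e^v − 1)^{j+1} · f_j(v) equals (j+1)! · C(j,k), where C(j,k) = k! · Σ_{r=0}^{k} (-1)^{r+1}(r+1)(r+2)(r+j)! · [S(k-r, j+1)/(k-r)!] · Σ_{q=0}^{r+1} ((-1)^q/(q+1)) · S(r+q+1, q)/((r-q+1)!(r+q+1)!). -/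
/-- `𝔤_j(v) = (e^v − 1)^{j+1} f_j(v)` where `f_j = G_j^{(j)}`. -/
noncomputable def frakg (j : ℕ) : ℝ → ℝ := fun v =>
  (Real.exp v - 1) ^ (j + 1) * iteratedDeriv j (G j) v

/-- The Taylor series at `0` of a real function. -/
noncomputable def taylorSeriesZero (f : ℝ → ℝ) : PowerSeries ℝ :=
  PowerSeries.mk fun n => iteratedDeriv n f 0 / n.factorial

lemma coeff_taylorSeriesZero (f : ℝ → ℝ) (n : ℕ) :
    PowerSeries.coeff n (taylorSeriesZero f) = iteratedDeriv n f 0 / n.factorial :=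
  PowerSeries.coeff_mk _ _

lemma iteratedDeriv_zero_eq_factorial_mul_coeff (f : ℝ → ℝ) (n : ℕ) :
    iteratedDeriv n f 0 = n.factorial * PowerSeries.coeff n (taylorSeriesZero f) := by
  rw [coeff_taylorSeriesZero]
  field_simp

lemma taylorSeriesZero_mul {f g : ℝ → ℝ} (hf : AnalyticAt ℝ f 0) (hg : AnalyticAt ℝ g 0) :
    taylorSeriesZero (f * g) = taylorSeriesZero f * taylorSeriesZero g := by
  ext n
  rw [coeff_taylorSeriesZero, iteratedDeriv_mul hf.contDiffAt hg.contDiffAt,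
    PowerSeries.coeff_mul, Finset.Nat.sum_antidiagonal_eq_sum_range_succ_mk, Finset.sum_div]
  refine Finset.sum_congr rfl fun i hi => ?_
  have hi : i ≤ n := Nat.lt_succ_iff.mp (Finset.mem_range.mp hi)
  rw [coeff_taylorSeriesZero, coeff_taylorSeriesZero, Nat.cast_choose ℝ hi]
  field_simp

lemma taylorSeriesZero_one : taylorSeriesZero 1 = 1 := by
  ext n
  rw [coeff_taylorSeriesZero, PowerSeries.coeff_one]
  change iteratedDeriv n (fun _ => (1 : ℝ)) 0 / _ = _
  rw [iteratedDeriv_const]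
  split_ifs with h <;> simp [h]

lemma taylorSeriesZero_pow {f : ℝ → ℝ} (hf : AnalyticAt ℝ f 0) (m : ℕ) :
    taylorSeriesZero (f ^ m) = taylorSeriesZero f ^ m := by
  induction m with
  | zero => simpa using taylorSeriesZero_one
  | succ m ih => rw [pow_succ, pow_succ, taylorSeriesZero_mul (hf.pow m) hf, ih]

lemma taylorSeriesZero_id_pow (m : ℕ) :
    taylorSeriesZero (fun v => v ^ m) = PowerSeries.X ^ m := by
  ext n
  rw [coeff_taylorSeriesZero, iteratedDeriv_fun_pow_zero, PowerSeries.coeff_X_pow]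
  split_ifs with h
  · subst h
    field_simp
  · simp

lemma taylorSeriesZero_exp_const_mul (c : ℝ) :
    taylorSeriesZero (fun v => Real.exp (c * v)) =
      PowerSeries.rescale c (PowerSeries.exp ℝ) := by
  ext n
  rw [coeff_taylorSeriesZero, iteratedDeriv_exp_const_mul, PowerSeries.coeff_rescale,
    PowerSeries.coeff_exp]
  simp [div_eq_mul_inv]

lemma taylorSeriesZero_sub {f g : ℝ → ℝ} (hf : AnalyticAt ℝ f 0) (hg : AnalyticAt ℝ g 0) :
    taylorSeriesZero (f - g) = taylorSeriesZero f - taylorSeriesZero g := by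
  ext n
  rw [map_sub, coeff_taylorSeriesZero, coeff_taylorSeriesZero, coeff_taylorSeriesZero,
    iteratedDeriv_sub hf.contDiffAt hg.contDiffAt, sub_div]

lemma taylorSeriesZero_exp_sub_one :
    taylorSeriesZero (fun v => Real.exp v - 1) = PowerSeries.exp ℝ - 1 := by
  have h := taylorSeriesZero_sub (f := fun v => Real.exp (1 * v)) (g := 1)
    (by fun_prop) analyticAt_const
  rw [taylorSeriesZero_exp_const_mul, taylorSeriesZero_one, PowerSeries.rescale_one] at h
  simpa [Pi.sub_def] using h

lemma taylorSeriesZero_one_sub_exp_neg :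
    taylorSeriesZero (fun v => 1 - Real.exp (-v)) =
      -PowerSeries.rescale (-1) (PowerSeries.exp ℝ - 1) := by
  have h := taylorSeriesZero_sub (f := 1) (g := fun v => Real.exp (-1 * v))
    analyticAt_const (by fun_prop)
  rw [taylorSeriesZero_exp_const_mul, taylorSeriesZero_one] at h
  simpa [Pi.sub_def] using h

/-- The exponential generating function of the Stirling numbers of the second kind. -/
lemma coeff_exp_sub_one_pow_s10 (n k : ℕ) :
    PowerSeries.coeff n ((PowerSeries.exp ℝ - 1) ^ k) =
      k.factorial * (S n k : ℝ) / n.factorial := by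
  induction n generalizing k with
  | zero =>
    rw [PowerSeries.coeff_zero_eq_constantCoeff_apply]
    cases k <;> simp [S]
  | succ n ih =>
    cases k with
    | zero => simp [S, PowerSeries.coeff_one]
    | succ k =>
      have hd : PowerSeries.derivative ℝ ((PowerSeries.exp ℝ - 1) ^ (k + 1)) =
          ((k + 1 : ℕ) : PowerSeries ℝ) * ((PowerSeries.exp ℝ - 1) ^ (k + 1)
            + (PowerSeries.exp ℝ - 1) ^ k) := by
        rw [Derivation.leibniz_pow, map_sub, PowerSeries.derivative_exp, Derivation.map_one_eq_zero]
        simp only [smul_eq_mul, nsmul_eq_mul, add_tsub_cancel_right, sub_zero]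
        ring
      have h := congrArg (PowerSeries.coeff n) hd
      rw [PowerSeries.coeff_derivative, ← nsmul_eq_mul, map_nsmul, map_add, ih, ih,
        nsmul_eq_mul] at h
      have hn : ((n : ℝ) + 1) ≠ 0 := by positivity
      rw [eq_div_of_mul_eq hn h]
      simp only [S, Nat.factorial_succ]
      push_cast
      field_simp

/-- If `b` is the inverse of a power series `w` with constant coefficient `1`, then the
coefficients of `b` are binomial combinations of the coefficients of the powers of `w`. -/
lemma coeff_eq_sum_choose_mul_coeff_pow {b w : PowerSeries ℝ} (hbw : b * w = 1)
    (hw : PowerSeries.constantCoeff w = 1) (n : ℕ) :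
    PowerSeries.coeff n b =
      ∑ q ∈ Finset.range (n + 1),
        (-1 : ℝ) ^ q * ((n + 1).choose (q + 1)) * PowerSeries.coeff n (w ^ q) := by
  set p : PowerSeries ℝ := ∑ q ∈ Finset.range (n + 1),
    PowerSeries.C ((-1 : ℝ) ^ q * ((n + 1).choose (q + 1))) * w ^ q with hp
  have hwp : w * p = 1 - (1 - w) ^ (n + 1) := by
    have h : (1 - w) ^ (n + 1) = (-w + 1) ^ (n + 1) := by ring
    rw [h, add_pow, Finset.sum_range_succ', hp, Finset.mul_sum]
    simp only [one_pow, mul_one, pow_zero, Nat.choose_zero_right, Nat.cast_one]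
    rw [sub_add_cancel_right, ← Finset.sum_neg_distrib]
    refine Finset.sum_congr rfl fun q _ => ?_
    simp only [map_mul, map_pow, map_neg, map_one, map_natCast]
    rw [neg_pow w]
    ring
  have hb : b = p + b * (1 - w) ^ (n + 1) := by
    linear_combination p * hbw - b * hwp
  have hX : PowerSeries.X ^ (n + 1) ∣ b * (1 - w) ^ (n + 1) := by
    refine Dvd.dvd.mul_left (pow_dvd_pow_of_dvd ?_ _) _
    rw [PowerSeries.X_dvd_iff]
    simp [hw]
  rw [hb, map_add, PowerSeries.X_pow_dvd_iff.mp hX n (Nat.lt_succ_self n), add_zero, hp, map_sum]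
  exact Finset.sum_congr rfl fun q _ => PowerSeries.coeff_C_mul _ _ _

/-- The entire function `(1 - e^{-v}) / v`. -/
noncomputable def oneSubExpNegDiv : ℝ → ℝ := dslope (fun v => 1 - Real.exp (-v)) 0

lemma oneSubExpNegDiv_zero : oneSubExpNegDiv 0 = 1 := by
  have h : HasDerivAt (fun v : ℝ => 1 - Real.exp (-v)) 1 0 := by
    simpa using ((hasDerivAt_neg (0 : ℝ)).exp.const_sub 1)
  rw [oneSubExpNegDiv, dslope_same, h.deriv]

lemma id_mul_oneSubExpNegDiv (v : ℝ) : v * oneSubExpNegDiv v = 1 - Real.exp (-v) := by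
  simpa [oneSubExpNegDiv] using sub_smul_dslope (fun v : ℝ => 1 - Real.exp (-v)) 0 v

lemma oneSubExpNegDiv_ne_zero (v : ℝ) : oneSubExpNegDiv v ≠ 0 := by
  rcases eq_or_ne v 0 with rfl | hv
  · simp [oneSubExpNegDiv_zero]
  · intro h
    have := id_mul_oneSubExpNegDiv v
    rw [h, mul_zero, eq_comm, sub_eq_zero, eq_comm, Real.exp_eq_one_iff, neg_eq_zero] at this
    exact hv this

lemma analyticAt_oneSubExpNegDiv : AnalyticAt ℝ oneSubExpNegDiv 0 := by
  have h : AnalyticAt ℝ (fun v : ℝ => 1 - Real.exp (-v)) 0 := by fun_prop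
  obtain ⟨p, hp⟩ := h
  exact ⟨_, hp.has_fpower_series_dslope_fslope⟩

lemma analyticAt_inv_oneSubExpNegDiv : AnalyticAt ℝ oneSubExpNegDiv⁻¹ 0 :=
  analyticAt_oneSubExpNegDiv.inv (oneSubExpNegDiv_ne_zero 0)

lemma X_mul_taylorSeriesZero_oneSubExpNegDiv :
    PowerSeries.X * taylorSeriesZero oneSubExpNegDiv =
      -PowerSeries.rescale (-1) (PowerSeries.exp ℝ - 1) := by
  rw [← taylorSeriesZero_one_sub_exp_neg, ← pow_one PowerSeries.X, ← taylorSeriesZero_id_pow,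
    ← taylorSeriesZero_mul (by fun_prop) analyticAt_oneSubExpNegDiv]
  congr 1
  ext v
  simpa using id_mul_oneSubExpNegDiv v

lemma coeff_taylorSeriesZero_oneSubExpNegDiv_pow (n q : ℕ) :
    PowerSeries.coeff n (taylorSeriesZero oneSubExpNegDiv ^ q) =
      (-1) ^ n * (q.factorial * (S (n + q) q : ℝ) / (n + q).factorial) := by
  rw [← PowerSeries.coeff_X_pow_mul _ q n, ← mul_pow, X_mul_taylorSeriesZero_oneSubExpNegDiv,
    neg_pow, ← map_pow]
  have h : ((-1 : PowerSeries ℝ)) ^ q = PowerSeries.C ((-1 : ℝ) ^ q) := by simp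
  rw [h, PowerSeries.coeff_C_mul, PowerSeries.coeff_rescale, coeff_exp_sub_one_pow_s10, pow_add]
  have h2 : ((-1 : ℝ) ^ q) * (-1) ^ q = 1 := by rw [← mul_pow]; simp
  linear_combination ((-1 : ℝ) ^ n * (q.factorial * (S (n + q) q : ℝ) / (n + q).factorial)) * h2

lemma coeff_taylorSeriesZero_inv_oneSubExpNegDiv (n : ℕ) :
    PowerSeries.coeff n (taylorSeriesZero oneSubExpNegDiv⁻¹) =
      (-1) ^ n * (n + 1).factorial * ∑ q ∈ Finset.range (n + 1),
        ((-1 : ℝ) ^ q / (q + 1)) * (S (n + q) q) /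
          ((n - q).factorial * (n + q).factorial) := by
  have hbw : taylorSeriesZero oneSubExpNegDiv⁻¹ * taylorSeriesZero oneSubExpNegDiv = 1 := by
    rw [← taylorSeriesZero_mul analyticAt_inv_oneSubExpNegDiv analyticAt_oneSubExpNegDiv,
      ← taylorSeriesZero_one]
    congr 1
    ext v
    simp [oneSubExpNegDiv_ne_zero v]
  have hw : PowerSeries.constantCoeff (taylorSeriesZero oneSubExpNegDiv) = 1 := by
    rw [← PowerSeries.coeff_zero_eq_constantCoeff_apply, coeff_taylorSeriesZero]
    simp [oneSubExpNegDiv_zero]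
  rw [coeff_eq_sum_choose_mul_coeff_pow hbw hw, Finset.mul_sum]
  refine Finset.sum_congr rfl fun q hq => ?_
  have hq : q ≤ n := Nat.lt_succ_iff.mp (Finset.mem_range.mp hq)
  rw [coeff_taylorSeriesZero_oneSubExpNegDiv_pow, Nat.cast_choose ℝ (Nat.succ_le_succ hq),
    Nat.succ_sub_succ, Nat.factorial_succ q]
  push_cast
  field_simp

lemma G_eq_pow_mul_inv {j : ℕ} (hj : 1 ≤ j) :
    G j = (fun v => v ^ (j - 1)) * oneSubExpNegDiv⁻¹ := by
  obtain ⟨i, rfl⟩ := Nat.exists_eq_add_of_le' hj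
  ext v
  rcases eq_or_ne v 0 with rfl | hv
  · simp [G, oneSubExpNegDiv_zero, zero_pow_eq]
  · have h := oneSubExpNegDiv_ne_zero v
    simp only [G, if_neg hv, Pi.mul_apply, Pi.inv_apply, add_tsub_cancel_right,
      ← id_mul_oneSubExpNegDiv]
    field_simp
    ring

lemma analyticAt_G {j : ℕ} (hj : 1 ≤ j) : AnalyticAt ℝ (G j) 0 := by
  rw [G_eq_pow_mul_inv hj]
  exact AnalyticAt.mul (by fun_prop) analyticAt_inv_oneSubExpNegDiv

lemma coeff_taylorSeriesZero_iteratedDeriv_G {j : ℕ} (hj : 1 ≤ j) (r : ℕ) :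
    PowerSeries.coeff r (taylorSeriesZero (iteratedDeriv j (G j))) =
      (r + j).factorial / r.factorial *
        PowerSeries.coeff (r + 1) (taylorSeriesZero oneSubExpNegDiv⁻¹) := by
  have h : iteratedDeriv r (iteratedDeriv j (G j)) = iteratedDeriv (r + j) (G j) := by
    simp only [iteratedDeriv_eq_iterate, Function.iterate_add_apply]
  have hrj : r + j = (r + 1) + (j - 1) := by omega
  rw [coeff_taylorSeriesZero, h, iteratedDeriv_zero_eq_factorial_mul_coeff]
  conv_lhs => rw [G_eq_pow_mul_inv hj,
    taylorSeriesZero_mul (by fun_prop) analyticAt_inv_oneSubExpNegDiv, taylorSeriesZero_id_pow]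
  conv_lhs => enter [1, 2, 1]; rw [hrj]
  rw [PowerSeries.coeff_X_pow_mul]
  ring

/-- `𝔤_j^{(k)}(0) = (j+1)! C(j,k)` with the explicit closed form for `C(j,k)` in terms of
Stirling numbers of the second kind. -/
theorem iteratedDeriv_frakg_zero (j k : ℕ) (hj : 1 ≤ j) :
    iteratedDeriv k (frakg j) 0 =
      (Nat.factorial (j + 1)) *
      ((Nat.factorial k) *
        ∑ r ∈ Finset.range (k + 1),
          (-1 : ℝ) ^ (r + 1) * (r + 1) * (r + 2) * (Nat.factorial (r + j)) *
            ((S (k - r) (j + 1) : ℝ) / (Nat.factorial (k - r))) *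
            ∑ q ∈ Finset.range (r + 2),
              ((-1 : ℝ) ^ q / (q + 1)) * (S (r + q + 1) q) /
                ((Nat.factorial (r + 1 - q)) * (Nat.factorial (r + q + 1)))) := by
  have hF : frakg j = (fun v => Real.exp v - 1) ^ (j + 1) * iteratedDeriv j (G j) := rfl
  have hE : AnalyticAt ℝ (fun v => Real.exp v - 1) 0 := by fun_prop
  have hf : AnalyticAt ℝ (iteratedDeriv j (G j)) 0 := by
    rw [iteratedDeriv_eq_iterate]
    exact (analyticAt_G hj).iterated_deriv j
  rw [iteratedDeriv_zero_eq_factorial_mul_coeff, hF, taylorSeriesZero_mul (hE.pow _) hf,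
    taylorSeriesZero_pow hE, taylorSeriesZero_exp_sub_one, mul_comm (_ ^ (j + 1)),
    PowerSeries.coeff_mul, Finset.Nat.sum_antidiagonal_eq_sum_range_succ_mk, mul_left_comm,
    Finset.mul_sum (a := ((j + 1).factorial : ℝ))]
  congr 1
  refine Finset.sum_congr rfl fun r _ => ?_
  rw [coeff_taylorSeriesZero_iteratedDeriv_G hj, coeff_taylorSeriesZero_inv_oneSubExpNegDiv,
    coeff_exp_sub_one_pow_s10]
  have hS : ∀ q, r + 1 + q = r + q + 1 := fun q => by omega
  simp only [hS]
  rw [Nat.factorial_succ (r + 1), Nat.factorial_succ r]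
  push_cast
  field_simp
  ring
end
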